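/- Let γ(k) be the maximum length of an s-primitive word over an alphabet of size k. Then for every k > 1, γ(k) ≤ (2k+2)(γ(k-1)+1) − 1. -/

import Mathlib

/-- `C` is an s-cover of `S`: `C` occurs in `S` as a subsequence, and every
position of `S` belongs to some occurrence of `C` as a subsequence, i.e. a
strictly increasing list of positions of `S` spelling `C`. -/
def IsSCover {α : Type*} (C S : List α) : Prop :=
  C.Sublist S ∧
    ∀ i : Fin S.length, ∃ I : List (Fin S.length),
      I.Chain' (fun a b => (a : ℕ) < (b : ℕ)) ∧ i ∈ I ∧ I.map S.get = C

/-- A word is s-primitive if it has no s-cover strictly shorter than itself. -/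
def SPrimitive {α : Type*} (S : List α) : Prop :=
  ∀ C : List α, IsSCover C S → S.length ≤ C.length

/-- `γ k` is the maximum length of an s-primitive word over an alphabet of size `k`
(words over `ℕ` using at most `k` distinct letters). -/
def GammaSpec (γ : ℕ → ℕ) : Prop :=
  ∀ k : ℕ,
    IsGreatest {n : ℕ | ∃ S : List ℕ, S.toFinset.card ≤ k ∧ SPrimitive S ∧ S.length = n} (γ k)

/-- Decomposition form of being an s-cover. -/
def Cov (C S : List ℕ) : Prop :=
  ∀ U a V, S = U ++ a :: V → ∃ X Y, C = X ++ a :: Y ∧ X.Sublist U ∧ Y.Sublist V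

lemma chain_iff {n : ℕ} (I : List (Fin n)) :
    I.IsChain (fun a b => (a : ℕ) < (b : ℕ)) ↔ I.Pairwise (fun a b => a < b) := by
  simp only [List.bind_eq_flatMap, List.pure_def]
  have e : List.flatMap (fun a : Fin n => [Fin.val a]) I = I.map Fin.val := by
    induction I with
    | nil => rfl
    | cons b I ih => simp [List.flatMap_cons, ih]
  rw [e, List.isChain_iff_pairwise, List.pairwise_map]
  rfl

lemma isSCover_of_cov {C S : List ℕ} (hs : C.Sublist S) (h : Cov C S) : IsSCover C S := by
  refine ⟨hs, fun i => ?_⟩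
  have hS : S = S.take i ++ S[i] :: S.drop (i + 1) := by simp
  generalize hU : S.take i = U at hS
  generalize hV : S.drop (i + 1) = V at hS
  obtain ⟨X, Y, hC, hX, hY⟩ := h _ _ _ hS
  obtain ⟨I1, e1, p1⟩ := List.sublist_eq_map_getElem hX
  obtain ⟨I2, e2, p2⟩ := List.sublist_eq_map_getElem hY
  have lU : U.length = i := by rw [← hU]; simp
  have lV : V.length = S.length - (i + 1) := by rw [← hV]; simp
  have hi := i.2
  refine ⟨I1.map (fun j => ⟨j.1, by omega⟩) ++ i :: I2.map (fun j => ⟨i + 1 + j.1, by omega⟩),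
    ?_, by simp, ?_⟩
  · refine (chain_iff _).2 ?_
    rw [List.pairwise_append, List.pairwise_cons]
    refine ⟨?_, ⟨?_, ?_⟩, ?_⟩
    · rw [List.pairwise_map]
      exact p1.imp (fun h => h)
    · intro a ha
      obtain ⟨j, _, rfl⟩ := List.mem_map.1 ha
      rw [Fin.lt_def]; simp only []; omega
    · rw [List.pairwise_map]
      refine p2.imp (fun {a b} h => ?_)
      rw [Fin.lt_def] at *; simp only []; omega
    · intro a ha b hb
      obtain ⟨j, _, rfl⟩ := List.mem_map.1 ha
      rcases List.mem_cons.1 hb with rfl | hb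
      · rw [Fin.lt_def]; simp only []; omega
      · obtain ⟨j', _, rfl⟩ := List.mem_map.1 hb
        rw [Fin.lt_def]; simp only []; omega
  · subst hU hV
    rw [hC, List.map_append, List.map_cons, e1, e2, List.map_map, List.map_map]
    congr 1
    · refine List.map_congr_left (fun j _ => ?_)
      simp
    · congr 1
      refine List.map_congr_left (fun j _ => ?_)
      simp

lemma cov_of_isSCover {C S : List ℕ} (h : IsSCover C S) : Cov C S := by
  rintro U a V rfl
  obtain ⟨I, hI, hm, hC⟩ := h.2 ⟨U.length, by simp⟩
  obtain ⟨I1, I2, rfl⟩ := List.append_of_mem hm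
  replace hI := (chain_iff _).1 hI
  rw [List.pairwise_append, List.pairwise_cons] at hI
  obtain ⟨q1, ⟨q2, q3⟩, q4⟩ := hI
  have hlen : (U ++ a :: V).length = U.length + 1 + V.length := by simp; omega
  let f : Fin U.length → Fin (U ++ a :: V).length := fun j => ⟨j.1, by omega⟩
  let g : Fin V.length → Fin (U ++ a :: V).length := fun j => ⟨U.length + 1 + j.1, by omega⟩
  have m1 : I1 ∈ Set.range (List.map f) := by
    rw [Set.range_list_map]
    intro x hx
    have := q4 x hx _ List.mem_cons_self
    rw [Fin.lt_def] at this
    exact ⟨⟨x.1, this⟩, rfl⟩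
  have m2 : I2 ∈ Set.range (List.map g) := by
    rw [Set.range_list_map]
    intro x hx
    have := q2 x hx
    rw [Fin.lt_def] at this
    simp only [] at this
    refine ⟨⟨x.1 - (U.length + 1), by omega⟩, ?_⟩
    apply Fin.ext
    simp only [g]
    omega
  obtain ⟨J1, rfl⟩ := m1
  obtain ⟨J2, rfl⟩ := m2
  rw [List.pairwise_map] at q1 q3
  refine ⟨J1.map (fun j => U[j]), J2.map (fun j => V[j]), ?_, ?_, ?_⟩
  · rw [← hC, List.map_append, List.map_cons, List.map_map, List.map_map]
    congr 1
    · refine List.map_congr_left (fun j _ => ?_)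
      simp [f]
    · congr 1
      · simp
      · refine List.map_congr_left (fun j _ => ?_)
        simp [g, List.getElem_append_right, Nat.add_assoc, Nat.add_comm 1]
  · exact List.map_getElem_sublist (q1.imp (fun h => h))
  · refine List.map_getElem_sublist (q3.imp (fun {a b} h => ?_))
    rw [Fin.lt_def] at *
    simp only [g] at h
    omega

lemma cov_append {C F : List ℕ} (hs : C.Sublist F) (h : Cov C F) (P Q : List ℕ) :
    Cov (P ++ C ++ Q) (P ++ F ++ Q) := by
  intro U a V hU
  rcases List.append_eq_append_iff.1 hU with ⟨W, e1, e2⟩ | ⟨W, e1, e2⟩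
  · -- position in `Q`
    refine ⟨P ++ C ++ W, V, by simp [e2], ?_, List.Sublist.refl _⟩
    rw [e1]
    exact ((List.Sublist.refl P).append hs).append (List.Sublist.refl _)
  · rcases W with _ | ⟨b, W⟩
    · refine ⟨P ++ C, V, by simpa using e2.symm, ?_, List.Sublist.refl _⟩
      simp only [List.append_nil] at e1
      rw [← e1]
      exact (List.Sublist.refl P).append hs
    · simp only [List.cons_append, List.cons.injEq] at e2
      obtain ⟨rfl, rfl⟩ := e2
      rcases List.append_eq_append_iff.1 e1 with ⟨Z, f1, f2⟩ | ⟨Z, f1, f2⟩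
      · obtain ⟨X, Y, hC, hX, hY⟩ := h _ _ _ f2
        refine ⟨P ++ X, Y ++ Q, by simp [hC], ?_, hY.append (List.Sublist.refl _)⟩
        rw [f1]
        exact (List.Sublist.refl P).append hX
      · rcases Z with _ | ⟨c, Z⟩
        · obtain ⟨X, Y, hC, hX, hY⟩ := h [] _ _ (by simpa using f2.symm)
          refine ⟨P ++ X, Y ++ Q, by simp [hC], ?_, hY.append (List.Sublist.refl _)⟩
          have hX' : X = [] := by simpa using hX
          simp [hX', f1]
        · simp only [List.cons_append, List.cons.injEq] at f2
          obtain ⟨rfl, rfl⟩ := f2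
          refine ⟨U, Z ++ C ++ Q, by simp [f1], List.Sublist.refl _, ?_⟩
          exact ((List.Sublist.refl Z).append hs).append (List.Sublist.refl _)

lemma sprimitive_infix {F S : List ℕ} (h : F <:+: S) (hS : SPrimitive S) : SPrimitive F := by
  obtain ⟨P, Q, rfl⟩ := h
  intro C hC
  have := hS (P ++ C ++ Q) (isSCover_of_cov
    (((List.Sublist.refl P).append hC.1).append (List.Sublist.refl _))
    (cov_append hC.1 (cov_of_isSCover hC) P Q))
  simp only [List.length_append] at this
  omega

lemma dedup_split (S : List ℕ) : ∀ U a V, S = U ++ a :: V →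
    ∃ X Y, S.dedup = X ++ a :: Y ∧ Y.Sublist V := by
  induction S with
  | nil => intro U a V h; simp at h
  | cons b T ih =>
    intro U a V h
    rcases U with _ | ⟨c, U⟩
    · simp only [List.nil_append, List.cons.injEq] at h
      obtain ⟨rfl, rfl⟩ := h
      by_cases hb : b ∈ T
      · obtain ⟨U', V', rfl⟩ := List.append_of_mem hb
        obtain ⟨X, Y, e, hY⟩ := ih U' b V' rfl
        refine ⟨X, Y, by rw [List.dedup_cons_of_mem hb, e], hY.trans ?_⟩
        exact ((List.sublist_cons_self b V')).trans (List.sublist_append_right _ _)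
      · exact ⟨[], T.dedup, by rw [List.dedup_cons_of_notMem hb]; rfl, List.dedup_sublist T⟩
    · simp only [List.cons_append, List.cons.injEq] at h
      obtain ⟨rfl, rfl⟩ := h
      obtain ⟨X, Y, e, hY⟩ := ih U a V rfl
      by_cases hb : b ∈ U ++ a :: V
      · exact ⟨X, Y, by rw [List.dedup_cons_of_mem hb, e], hY⟩
      · exact ⟨b :: X, Y, by rw [List.dedup_cons_of_notMem hb, e]; rfl, hY⟩

lemma sublist_of_rich (m : ℕ) (w : List ℕ) : ∀ T : List ℕ,
    (∀ F, F <:+: T → F.length = m → ∀ x ∈ w, x ∈ F) → w.length * m ≤ T.length →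
    w.Sublist T := by
  induction w with
  | nil => intro T _ _; simp
  | cons a w ih =>
    intro T h hl
    simp only [List.length_cons, Nat.add_mul] at hl
    have h1 : a ∈ T.take m :=
      h _ (List.take_prefix m T).isInfix (by simp; omega) a List.mem_cons_self
    have h2 : w.Sublist (T.drop m) := by
      refine ih _ (fun F hF hm x hx => ?_) (by simp; omega)
      exact h F (hF.trans (List.drop_suffix m T).isInfix) hm x (List.mem_cons_of_mem _ hx)
    have := (List.singleton_sublist.2 h1).append h2
    simpa using this

/-- The candidate cover: letters by first occurrence, then letters by last occurrence. -/
def cand (S : List ℕ) : List ℕ := S.reverse.dedup.reverse ++ S.dedup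

lemma cand_reverse (S : List ℕ) : cand S.reverse = (cand S).reverse := by
  simp [cand]

lemma half (k m : ℕ) (S : List ℕ) (hk : S.toFinset.card ≤ k)
    (H : ∀ F, F <:+: S → F.length = m → ∀ x ∈ S, x ∈ F)
    (U : List ℕ) (a : ℕ) (V : List ℕ) (hS : S = U ++ a :: V) (hV : (k + 1) * m ≤ V.length) :
    ∃ X Y, cand S = X ++ a :: Y ∧ X.Sublist U ∧ Y.Sublist V := by
  obtain ⟨Y, X, e, hX⟩ := dedup_split S.reverse V.reverse a U.reverse (by simp [hS])
  have e' : S.reverse.dedup.reverse = X.reverse ++ a :: Y.reverse := by simp [e]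
  refine ⟨X.reverse, Y.reverse ++ S.dedup, by simp [cand, e], ?_, ?_⟩
  · simpa using hX.reverse
  have hYk : Y.length ≤ k := by
    have h1 : S.reverse.dedup.length = S.toFinset.card := by
      rw [← List.toFinset_reverse, List.card_toFinset]
    rw [e] at h1
    simp at h1
    omega
  rw [Nat.add_mul, one_mul] at hV
  obtain ⟨V1, V2, rfl, l2⟩ : ∃ V1 V2, V = V1 ++ V2 ∧ V2.length = m :=
    ⟨V.take (V.length - m), V.drop (V.length - m), by simp, by simp; omega⟩
  have i1 : V1 <:+: S := ⟨U ++ [a], V2, by simp [hS]⟩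
  have i2 : V2 <:+: S := ⟨U ++ a :: V1, [], by simp [hS]⟩
  refine List.Sublist.append ?_ ?_
  · apply sublist_of_rich m
    · intro F hF hm x hx
      refine H F (hF.trans i1) hm x ?_
      have : x ∈ S.reverse.dedup := by rw [e]; simp at hx; simp [hx]
      simpa using this
    · have := Nat.mul_le_mul_right m hYk
      simp at hV ⊢
      omega
  · have : S.dedup = V2.dedup := by
      have hS' : S = (U ++ a :: V1) ++ V2 := by simp [hS]
      rw [hS', List.dedup_append]
      apply List.Subset.union_eq_right
      intro x hx
      rw [List.mem_dedup]
      refine H V2 i2 l2 x ?_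
      rw [hS']
      exact List.mem_append_left _ hx
    rw [this]
    exact List.dedup_sublist _

lemma cov_cand (k m : ℕ) (S : List ℕ) (hk : S.toFinset.card ≤ k)
    (H : ∀ F, F <:+: S → F.length = m → ∀ x ∈ S, x ∈ F)
    (hl : (2 * k + 2) * m ≤ S.length) : Cov (cand S) S := by
  intro U a V hS
  by_cases hV : (k + 1) * m ≤ V.length
  · exact half k m S hk H U a V hS hV
  · have hU : (k + 1) * m ≤ U.length := by
      have : (2 * k + 2) * m = (k + 1) * m + (k + 1) * m := by ring
      have : S.length = U.length + V.length + 1 := by simp [hS]; omega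
      omega
    obtain ⟨X, Y, e, hX, hY⟩ := half k m S.reverse (by simpa using hk)
      (fun F hF hm x hx => by
        have := H F.reverse (by rw [← List.reverse_infix]; simpa using hF) (by simpa using hm) x
          (by simpa using hx)
        simpa using this)
      V.reverse a U.reverse (by simp [hS]) (by simpa using hU)
    rw [cand_reverse] at e
    refine ⟨Y.reverse, X.reverse, ?_, ?_, ?_⟩
    · rw [← List.reverse_reverse (cand S), e]; simp
    · simpa using hY.reverse
    · simpa using hX.reverse

theorem gamma_upper_bound (γ : ℕ → ℕ) (hγ : GammaSpec γ) (k : ℕ) (hk : 1 < k) :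
    γ k ≤ (2 * k + 2) * (γ (k - 1) + 1) - 1 := by
  obtain ⟨S, hc, hp, hlen⟩ := (hγ k).1
  by_contra hcon
  have hl : (2 * k + 2) * (γ (k - 1) + 1) ≤ S.length := by omega
  have H : ∀ F, F <:+: S → F.length = γ (k - 1) + 1 → ∀ x ∈ S, x ∈ F := by
    intro F hF hm x hx
    have hFk : k ≤ F.toFinset.card := by
      by_contra hlt
      have := (hγ (k - 1)).2 ⟨F, by omega, sprimitive_infix hF hp, rfl⟩
      omega
    have hsub : F.toFinset ⊆ S.toFinset := by
      intro y hy
      rw [List.mem_toFinset] at *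
      exact hF.subset hy
    have := Finset.eq_of_subset_of_card_le hsub (by omega)
    rw [← List.mem_toFinset, this, List.mem_toFinset]
    exact hx
  have hcov := cov_cand k _ S hc H hl
  have hpos : 2 * k + 2 ≤ S.length :=
    le_trans (Nat.le_mul_of_pos_right _ (Nat.succ_pos _)) hl
  have hsubl : (cand S).Sublist S := by
    obtain ⟨a, T, rfl⟩ : ∃ a T, S = a :: T := by
      rcases S with _ | ⟨a, T⟩
      · simp at hpos
      · exact ⟨a, T, rfl⟩
    obtain ⟨X, Y, e, hX, hY⟩ := hcov [] a T rfl
    rw [e]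
    exact hX.append (hY.cons_cons a)
  have := hp _ (isSCover_of_cov hsubl hcov)
  have h1 : S.reverse.dedup.length = S.toFinset.card := by
    rw [← List.toFinset_reverse, List.card_toFinset]
  have h2 : S.dedup.length = S.toFinset.card := by
    rw [List.card_toFinset]
  simp only [cand, List.length_append, List.length_reverse] at this
  omega
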